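/- arXiv:1810.12182 — 7 statements merged into one kernel-verified Lean document; each statement's English description precedes it below -/
import Mathlib

section
/- For every state x ∈ ℕ and every feasible toll vector u, the expected cost per time step satisfies g(x,u) ≥ k0l·(θ / TSTT x u) + Σ_r (kl r)·(u r). -/
theorem hasSum_of_pointwise_eq {f g : ℕ → ℝ} {s : ℝ} (h : HasSum f s)
    (e : ∀ y, g y = f y) : HasSum g s := by
  rw [show g = f from funext e]
  exact h

theorem poisson_affine_hasSum (l a b : ℝ) :
    HasSum (fun y : ℕ => Real.exp (-l) * l ^ y / (Nat.factorial y : ℝ) * (a * y + b))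
      (a * l + b) := by
  have h0 : HasSum (fun y : ℕ => l ^ y / (Nat.factorial y : ℝ)) (Real.exp l) := by
    rw [Real.exp_eq_exp_ℝ]
    exact NormedSpace.expSeries_div_hasSum_exp l
  have h1 : HasSum (fun y : ℕ => l ^ y / (Nat.factorial y : ℝ) * (y : ℝ)) (l * Real.exp l) := by
    rw [← hasSum_nat_add_iff' 1]
    have h2 := h0.mul_left l
    simp only [Finset.sum_range_one, Nat.cast_zero, mul_zero, sub_zero]
    refine hasSum_of_pointwise_eq h2 ?_
    intro y
    rw [Nat.factorial_succ]
    have hy : (Nat.factorial y : ℝ) ≠ 0 := by positivity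
    have hy' : (y : ℝ) + 1 ≠ 0 := by positivity
    push_cast
    field_simp
    ring
  have h3 := ((h1.mul_left a).add (h0.mul_left b)).mul_left (Real.exp (-l))
  have e : Real.exp (-l) * Real.exp l = 1 := by rw [← Real.exp_add]; simp
  have e2 : Real.exp (-l) * (a * (l * Real.exp l) + b * Real.exp l) = a * l + b := by
    linear_combination (a * l + b) * e
  rw [e2] at h3
  refine hasSum_of_pointwise_eq h3 ?_
  intro y
  ring

theorem stmt1
    (R : ℕ) (hR : 1 ≤ R)
    (θ τmin τmax : ℝ) (hθ : 0 < θ) (hτmin : 0 < τmin) (hττ : τmin ≤ τmax)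
    (TSTT : ℕ → (Fin R → ℝ) → ℝ)
    (k0l k0m : ℝ) (kl km : Fin R → ℝ)
    (hk0l : 0 < k0l) (hk0 : k0l ≤ k0m)
    (hklpos : ∀ r, 0 < kl r) (hklm : ∀ r, kl r ≤ km r)
    (hTSTT_lb : ∀ (x : ℕ) (u : Fin R → ℝ), (∀ r, τmin ≤ u r ∧ u r ≤ τmax) →
      k0l * x + ∑ r, kl r * u r ≤ TSTT x u)
    (hTSTT_ub : ∀ (x : ℕ) (u : Fin R → ℝ), (∀ r, τmin ≤ u r ∧ u r ≤ τmax) →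
      TSTT x u ≤ k0m * x + ∑ r, km r * u r)
    (p : ℕ → ℕ → (Fin R → ℝ) → ℝ)
    (hp : ∀ (x y : ℕ) (u : Fin R → ℝ), p x y u =
      Real.exp (-(θ / TSTT x u)) * (θ / TSTT x u) ^ y / (Nat.factorial y : ℝ))
    (g : ℕ → (Fin R → ℝ) → ℝ)
    (hg : ∀ (x : ℕ) (u : Fin R → ℝ), g x u = ∑' y : ℕ, p x y u * TSTT y u)
    (x : ℕ) (u : Fin R → ℝ) (hu : ∀ r, τmin ≤ u r ∧ u r ≤ τmax) :
    k0l * (θ / TSTT x u) + ∑ r, kl r * u r ≤ g x u := by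
  have hS : ∀ k : Fin R → ℝ, (∀ r, 0 < k r) → 0 ≤ ∑ r, k r * u r := fun k hk =>
    Finset.sum_nonneg fun r _ => mul_nonneg (hk r).le (hτmin.le.trans (hu r).1)
  have hT : ∀ y, 0 ≤ TSTT y u := fun y =>
    le_trans (add_nonneg (by positivity) (hS kl hklpos)) (hTSTT_lb y u hu)
  have hl : 0 ≤ θ / TSTT x u := div_nonneg hθ.le (hT x)
  have hpn : ∀ y, 0 ≤ p x y u := fun y => by rw [hp]; positivity
  have hL := poisson_affine_hasSum (θ / TSTT x u) k0l (∑ r, kl r * u r)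
  have hU := poisson_affine_hasSum (θ / TSTT x u) k0m (∑ r, km r * u r)
  simp only [← hp] at hL hU
  have hs : Summable (fun y => p x y u * TSTT y u) :=
    Summable.of_nonneg_of_le (fun y => mul_nonneg (hpn y) (hT y))
      (fun y => mul_le_mul_of_nonneg_left (hTSTT_ub y u hu) (hpn y)) hU.summable
  rw [hg]
  exact hasSum_le (fun y => mul_le_mul_of_nonneg_left (hTSTT_lb y u hu) (hpn y)) hL hs.hasSum
end

section
/- For every policy μ, the expected return time to state 0 is finite: N_μ = Σ_{k=1}^∞ k·f_k(μ) < ∞. -/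
theorem path_bound (G : ℕ → ℕ → ENNReal) (q : ENNReal) (hG : ∀ x, ∑' y, G x y ≤ q) (n : ℕ) :
    ∀ x : ℕ, ∑' v : Fin n → ℕ,
      ∏ m : Fin n, G ((Fin.cons x v : Fin (n + 1) → ℕ) m.castSucc) (v m) ≤ q ^ n := by
  induction n with
  | zero => intro x; simp
  | succ n ih =>
    intro x
    rw [← (Fin.consEquiv (fun _ : Fin (n + 1) => ℕ)).tsum_eq, ENNReal.tsum_prod']
    have key : ∀ (a : ℕ) (b : Fin n → ℕ),
        ∏ m : Fin (n + 1), G ((Fin.cons x (Fin.consEquiv (fun _ : Fin (n + 1) => ℕ) (a, b)) :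
            Fin (n + 2) → ℕ) m.castSucc) (Fin.consEquiv (fun _ : Fin (n + 1) => ℕ) (a, b) m)
          = G x a * ∏ m : Fin n, G ((Fin.cons a b : Fin (n + 1) → ℕ) m.castSucc) (b m) := by
      intro a b
      rw [Fin.prod_univ_succ]
      congr 1
    simp only [key, ENNReal.tsum_mul_left]
    calc ∑' a, G x a * _ ≤ ∑' a, G x a * q ^ n :=
          ENNReal.tsum_le_tsum fun a => mul_le_mul_right (ih a) _
      _ = (∑' a, G x a) * q ^ n := ENNReal.tsum_mul_right
      _ ≤ q * q ^ n := mul_le_mul_left (hG x) _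
      _ = q ^ (n + 1) := (pow_succ' q n).symm

theorem stmt5
    (R : ℕ) (hR : 1 ≤ R)
    (θ τmin τmax : ℝ) (hθ : 0 < θ) (hτmin : 0 < τmin) (hττ : τmin ≤ τmax)
    (TSTT : ℕ → (Fin R → ℝ) → ℝ)
    (k0l k0m : ℝ) (kl km : Fin R → ℝ)
    (hk0l : 0 < k0l) (hk0 : k0l ≤ k0m)
    (hklpos : ∀ r, 0 < kl r) (hklm : ∀ r, kl r ≤ km r)
    (hTSTT_lb : ∀ (x : ℕ) (u : Fin R → ℝ), (∀ r, τmin ≤ u r ∧ u r ≤ τmax) →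
      k0l * x + ∑ r, kl r * u r ≤ TSTT x u)
    (hTSTT_ub : ∀ (x : ℕ) (u : Fin R → ℝ), (∀ r, τmin ≤ u r ∧ u r ≤ τmax) →
      TSTT x u ≤ k0m * x + ∑ r, km r * u r)
    (p : ℕ → ℕ → (Fin R → ℝ) → ℝ)
    (hp : ∀ (x y : ℕ) (u : Fin R → ℝ), p x y u =
      Real.exp (-(θ / TSTT x u)) * (θ / TSTT x u) ^ y / (Nat.factorial y : ℝ))
    (μ : ℕ → Fin R → ℝ) (hμ : ∀ (i : ℕ) (r : Fin R), τmin ≤ μ i r ∧ μ i r ≤ τmax)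
    (f : ℕ → ℝ)
    (hf : ∀ k : ℕ, 1 ≤ k → f k =
      ∑' w : {w : Fin (k + 1) → ℕ // w 0 = 0 ∧ w (Fin.last k) = 0 ∧
          ∀ m : Fin (k + 1), m ≠ 0 → m ≠ Fin.last k → w m ≠ 0},
        ∏ m : Fin k, p (w.1 m.castSucc) (w.1 m.succ) (μ (w.1 m.castSucc)))
 :
    (∑' k : ℕ, ENNReal.ofReal ((k : ℝ) * f k)) < ⊤ := by
  have hne : Nonempty (Fin R) := ⟨⟨0, hR⟩⟩
  set c : ℝ := ∑ r, kl r * τmin with hc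
  have hcpos : 0 < c := Finset.sum_pos (fun r _ => mul_pos (hklpos r) hτmin) Finset.univ_nonempty
  have hT : ∀ x, c ≤ TSTT x (μ x) := by
    intro x
    refine le_trans ?_ (hTSTT_lb x (μ x) (hμ x))
    have h1 : c ≤ ∑ r, kl r * μ x r :=
      Finset.sum_le_sum fun r _ => mul_le_mul_of_nonneg_left (hμ x r).1 (hklpos r).le
    have h2 : 0 ≤ k0l * (x : ℝ) := by positivity
    linarith
  set q : ℝ := 1 - Real.exp (-(θ / c)) with hq
  have hLpos : 0 < θ / c := div_pos hθ hcpos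
  have hq0 : 0 < q := by
    have : Real.exp (-(θ / c)) < 1 := by rw [← Real.exp_zero]; exact Real.exp_lt_exp.mpr (by linarith)
    linarith
  have hq1 : q < 1 := by
    have := Real.exp_pos (-(θ / c))
    linarith
  have hlam0 : ∀ x, 0 ≤ θ / TSTT x (μ x) := fun x => (div_pos hθ (hcpos.trans_le (hT x))).le
  have hlam : ∀ x, θ / TSTT x (μ x) ≤ θ / c := fun x =>
    div_le_div_of_nonneg_left hθ.le hcpos (hT x)
  have hp0 : ∀ x y, 0 ≤ p x y (μ x) := by
    intro x y
    rw [hp]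
    have := hlam0 x
    positivity
  have hsum : ∀ x, HasSum (fun y => p x y (μ x)) 1 := by
    intro x
    have h := (NormedSpace.expSeries_div_hasSum_exp (θ / TSTT x (μ x))).mul_left
      (Real.exp (-(θ / TSTT x (μ x))))
    rw [← Real.exp_eq_exp_ℝ, ← Real.exp_add, neg_add_cancel, Real.exp_zero] at h
    refine h.congr_fun ?_
    intro y
    rw [hp, mul_div_assoc]
  have hple : ∀ x y, p x y (μ x) ≤ 1 := fun x y => le_hasSum (hsum x) y fun z _ => hp0 x z
  let G : ℕ → ℕ → ENNReal := fun x y => ENNReal.ofReal (if y = 0 then 0 else p x y (μ x))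
  have hG : ∀ x, ∑' y, G x y ≤ ENNReal.ofReal q := by
    intro x
    have h := (hsum x).sub (hasSum_ite_eq 0 (p x 0 (μ x)))
    have h' : HasSum (fun y => if y = 0 then 0 else p x y (μ x)) (1 - p x 0 (μ x)) := by
      refine h.congr_fun ?_
      intro y
      by_cases hy : y = 0 <;> simp [hy]
    have h0 : ∀ y, 0 ≤ (if y = 0 then 0 else p x y (μ x)) := by
      intro y
      split_ifs
      · exact le_rfl
      · exact hp0 x y
    change ∑' y, ENNReal.ofReal (if y = 0 then 0 else p x y (μ x)) ≤ _
    rw [← ENNReal.ofReal_tsum_of_nonneg h0 h'.summable, h'.tsum_eq]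
    apply ENNReal.ofReal_le_ofReal
    have : Real.exp (-(θ / c)) ≤ p x 0 (μ x) := by
      rw [hp]
      simpa using hlam x
    linarith
  have hfk : ∀ n : ℕ, ENNReal.ofReal (f (n + 1)) ≤ ENNReal.ofReal q ^ n := by
    intro n
    rw [hf (n + 1) (by omega)]
    refine le_trans ?_ (path_bound G _ hG n 0)
    have hnn : ∀ w : {w : Fin (n + 1 + 1) → ℕ // w 0 = 0 ∧ w (Fin.last (n + 1)) = 0 ∧
          ∀ m : Fin (n + 1 + 1), m ≠ 0 → m ≠ Fin.last (n + 1) → w m ≠ 0},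
        0 ≤ ∏ m : Fin (n + 1), p (w.1 m.castSucc) (w.1 m.succ) (μ (w.1 m.castSucc)) :=
      fun w => Finset.prod_nonneg fun m _ => hp0 _ _
    refine le_trans (b := ∑' w : {w : Fin (n + 1 + 1) → ℕ // w 0 = 0 ∧ w (Fin.last (n + 1)) = 0 ∧
          ∀ m : Fin (n + 1 + 1), m ≠ 0 → m ≠ Fin.last (n + 1) → w m ≠ 0},
        ENNReal.ofReal
          (∏ m : Fin (n + 1), p (w.1 m.castSucc) (w.1 m.succ) (μ (w.1 m.castSucc)))) ?_ ?_
    · by_cases hs : Summable fun w : {w : Fin (n + 1 + 1) → ℕ // w 0 = 0 ∧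
          w (Fin.last (n + 1)) = 0 ∧
          ∀ m : Fin (n + 1 + 1), m ≠ 0 → m ≠ Fin.last (n + 1) → w m ≠ 0} =>
          ∏ m : Fin (n + 1), p (w.1 m.castSucc) (w.1 m.succ) (μ (w.1 m.castSucc))
      · exact (ENNReal.ofReal_tsum_of_nonneg hnn hs).le
      · rw [tsum_eq_zero_of_not_summable hs]; simp
    · let e : {w : Fin (n + 1 + 1) → ℕ // w 0 = 0 ∧ w (Fin.last (n + 1)) = 0 ∧
          ∀ m : Fin (n + 1 + 1), m ≠ 0 → m ≠ Fin.last (n + 1) → w m ≠ 0} → (Fin n → ℕ) :=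
        fun w m => w.1 m.castSucc.succ
      have he : Function.Injective e := by
        intro w w' hww
        apply Subtype.ext
        funext i
        refine Fin.cases ?_ (fun j => ?_) i
        · rw [w.2.1, w'.2.1]
        · refine Fin.lastCases ?_ (fun m => ?_) j
          · rw [Fin.succ_last, w.2.2.1, w'.2.2.1]
          · exact congrFun hww m
      refine le_trans (ENNReal.tsum_le_tsum fun w => ?_)
        (ENNReal.tsum_comp_le_tsum_of_injective he _)
      rw [Fin.prod_univ_castSucc]
      refine le_trans (ENNReal.ofReal_le_ofReal (mul_le_of_le_one_right
        (Finset.prod_nonneg fun m _ => hp0 _ _) (hple _ _))) ?_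
      rw [ENNReal.ofReal_prod_of_nonneg fun m _ => hp0 _ _]
      apply le_of_eq
      refine Finset.prod_congr rfl fun m _ => ?_
      have hz : e w m ≠ 0 := by
        refine w.2.2.2 _ (Fin.succ_ne_zero _) ?_
        intro h
        rw [← Fin.succ_last] at h
        exact (Fin.castSucc_lt_last m).ne (Fin.succ_injective _ h)
      have hc2 : (Fin.cons 0 (e w) : Fin (n + 1) → ℕ) m.castSucc = w.1 m.castSucc.castSucc := by
        have : ∀ j : Fin (n + 1), j ≠ Fin.last n ∨ True →
            ∀ i : Fin n, j = i.castSucc →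
            (Fin.cons 0 (e w) : Fin (n + 1) → ℕ) j = w.1 j.castSucc := by
          intro j _
          refine Fin.cases ?_ (fun a => ?_) j
          · intro i _
            rw [Fin.cons_zero, Fin.castSucc_zero, w.2.1]
          · intro i _
            rw [Fin.cons_succ]
            rfl
        exact this _ (Or.inr trivial) m rfl
      change _ = ENNReal.ofReal (if e w m = 0 then 0 else _)
      rw [if_neg hz, hc2]
  have hfin : Summable fun n : ℕ => ((n : ℝ) + 1) * q ^ n := by
    have h1 := summable_pow_mul_geometric_of_norm_lt_one (R := ℝ) 1
      (r := q) (by rw [Real.norm_eq_abs, abs_of_pos hq0]; exact hq1)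
    have h2 := summable_geometric_of_lt_one hq0.le hq1
    refine (h1.add h2).congr ?_
    intro n
    ring
  rw [tsum_eq_zero_add' ENNReal.summable]
  simp only [Nat.cast_zero, zero_mul, ENNReal.ofReal_zero, zero_add]
  refine lt_of_le_of_lt (ENNReal.tsum_le_tsum (g := fun n : ℕ =>
    ENNReal.ofReal (((n : ℝ) + 1) * q ^ n)) fun n => ?_) hfin.tsum_ofReal_lt_top
  have hn : (0 : ℝ) ≤ (n : ℝ) + 1 := by positivity
  rw [Nat.cast_add, Nat.cast_one, ENNReal.ofReal_mul hn, ENNReal.ofReal_mul hn,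
    ENNReal.ofReal_pow hq0.le]
  exact mul_le_mul_right (hfk n) _
end

section
/- The expected return times to state 0 are uniformly bounded over policies: there exists a real number N̄ > 0 such that for every policy μ, N_μ = Σ_{k=1}^∞ k·f_k(μ) ≤ N̄. -/
theorem aux_chain (Q : ℕ → ℕ → ENNReal) (q : ENNReal) (hQ : ∀ x, ∑' y, Q x y ≤ q) :
    ∀ (k x : ℕ), ∑' v : Fin k → ℕ,
      ∏ m : Fin k, Q ((Fin.cons x v : Fin (k + 1) → ℕ) m.castSucc) (v m) ≤ q ^ k := by
  intro k
  induction k with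
  | zero => intro x; simp
  | succ k ih =>
    intro x
    rw [← (Fin.consEquiv (fun _ : Fin (k + 1) => ℕ)).tsum_eq, ENNReal.tsum_prod']
    have h : ∀ (a : ℕ) (v : Fin k → ℕ),
        (∏ m : Fin (k + 1), Q ((Fin.cons x (Fin.consEquiv (fun _ : Fin (k + 1) => ℕ) (a, v)) :
          Fin (k + 2) → ℕ) m.castSucc) (Fin.consEquiv (fun _ : Fin (k + 1) => ℕ) (a, v) m))
        = Q x a * ∏ m : Fin k, Q ((Fin.cons a v : Fin (k + 1) → ℕ) m.castSucc) (v m) := by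
      intro a v
      rw [Fin.prod_univ_succ]
      congr 1
    simp_rw [h, ENNReal.tsum_mul_left]
    calc ∑' a, Q x a * ∑' v : Fin k → ℕ,
          ∏ m : Fin k, Q ((Fin.cons a v : Fin (k + 1) → ℕ) m.castSucc) (v m)
        ≤ ∑' a, Q x a * q ^ k := ENNReal.tsum_le_tsum fun a => by gcongr; exact ih a
      _ = (∑' a, Q x a) * q ^ k := ENNReal.tsum_mul_right
      _ ≤ q * q ^ k := by gcongr; exact hQ x
      _ = q ^ (k + 1) := by rw [pow_succ']

theorem aux_return (P : ℕ → ℕ → ENNReal) (q : ENNReal)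
    (hP : ∀ x, ∑' y, P x (y + 1) ≤ q) (hP0 : ∀ x, P x 0 ≤ 1) (k : ℕ) :
    ∑' w : {w : Fin (k + 1 + 1) → ℕ // w 0 = 0 ∧ w (Fin.last (k + 1)) = 0 ∧
          ∀ m : Fin (k + 1 + 1), m ≠ 0 → m ≠ Fin.last (k + 1) → w m ≠ 0},
        ∏ m : Fin (k + 1), P (w.1 m.castSucc) (w.1 m.succ) ≤ q ^ k := by
  let Q : ℕ → ℕ → ENNReal := fun x y => if y = 0 then 0 else P x y
  have hQ : ∀ x, ∑' y, Q x y ≤ q := by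
    intro x
    rw [tsum_eq_zero_add' ENNReal.summable]
    simpa [Q] using hP x
  refine le_trans ?_ (aux_chain Q q hQ k 0)
  let S := {w : Fin (k + 1 + 1) → ℕ // w 0 = 0 ∧ w (Fin.last (k + 1)) = 0 ∧
          ∀ m : Fin (k + 1 + 1), m ≠ 0 → m ≠ Fin.last (k + 1) → w m ≠ 0}
  let φ : S → (Fin k → ℕ) := fun w m => w.1 m.succ.castSucc
  have hφ : Function.Injective φ := by
    intro w w' h
    apply Subtype.ext
    funext i
    refine Fin.lastCases ?_ (fun j => ?_) i
    · rw [w.2.2.1, w'.2.2.1]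
    · refine Fin.cases ?_ (fun l => ?_) j
      · exact w.2.1.trans w'.2.1.symm
      · exact congrFun h l
  refine le_trans (ENNReal.tsum_le_tsum fun w => ?_)
    (ENNReal.tsum_comp_le_tsum_of_injective hφ (fun v : Fin k → ℕ =>
      ∏ m : Fin k, Q ((Fin.cons 0 v : Fin (k + 1) → ℕ) m.castSucc) (v m)))
  have hc : (Fin.cons 0 (φ w) : Fin (k + 1) → ℕ) = fun i => w.1 i.castSucc := by
    funext i
    refine Fin.cases ?_ (fun l => ?_) i
    · exact w.2.1.symm
    · rfl
  rw [Fin.prod_univ_castSucc, hc]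
  have h1 : P (w.1 (Fin.last k).castSucc) (w.1 (Fin.last k).succ) ≤ 1 := by
    rw [Fin.succ_last, w.2.2.1]; exact hP0 _
  refine le_trans (mul_le_mul_right h1 _) ?_
  rw [mul_one]
  apply le_of_eq
  apply Finset.prod_congr rfl
  intro m _
  have : φ w m ≠ 0 := w.2.2.2 _ (by simp [Fin.ext_iff]) (by simp [Fin.ext_iff]; omega)
  simp only [Q, if_neg this]
  rfl

theorem aux_tail (l L : ℝ) (hl : 0 ≤ l) (hL : l ≤ L) :
    ∑' y : ℕ, ENNReal.ofReal (Real.exp (-l) * l ^ (y + 1) / ((y + 1).factorial : ℝ))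
      ≤ ENNReal.ofReal (1 - Real.exp (-L)) := by
  have h : HasSum (fun y : ℕ => Real.exp (-l) * l ^ y / (y.factorial : ℝ)) 1 := by
    have := (NormedSpace.expSeries_div_hasSum_exp (𝔸 := ℝ) l).mul_left (Real.exp (-l))
    rw [← Real.exp_eq_exp_ℝ, ← Real.exp_add] at this
    simpa [mul_div_assoc] using this
  have h' := (hasSum_nat_add_iff' 1).mpr h
  rw [← ENNReal.ofReal_tsum_of_nonneg (fun y => by positivity) h'.summable, h'.tsum_eq]
  apply ENNReal.ofReal_le_ofReal
  simp only [Finset.sum_range_one, pow_zero, Nat.factorial_zero, Nat.cast_one, mul_one, div_one]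
  have : Real.exp (-L) ≤ Real.exp (-l) := Real.exp_le_exp.mpr (by linarith)
  linarith


theorem stmt6
    (R : ℕ) (hR : 1 ≤ R)
    (θ τmin τmax : ℝ) (hθ : 0 < θ) (hτmin : 0 < τmin) (hττ : τmin ≤ τmax)
    (TSTT : ℕ → (Fin R → ℝ) → ℝ)
    (k0l k0m : ℝ) (kl km : Fin R → ℝ)
    (hk0l : 0 < k0l) (hk0 : k0l ≤ k0m)
    (hklpos : ∀ r, 0 < kl r) (hklm : ∀ r, kl r ≤ km r)
    (hTSTT_lb : ∀ (x : ℕ) (u : Fin R → ℝ), (∀ r, τmin ≤ u r ∧ u r ≤ τmax) →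
      k0l * x + ∑ r, kl r * u r ≤ TSTT x u)
    (hTSTT_ub : ∀ (x : ℕ) (u : Fin R → ℝ), (∀ r, τmin ≤ u r ∧ u r ≤ τmax) →
      TSTT x u ≤ k0m * x + ∑ r, km r * u r)
    (p : ℕ → ℕ → (Fin R → ℝ) → ℝ)
    (hp : ∀ (x y : ℕ) (u : Fin R → ℝ), p x y u =
      Real.exp (-(θ / TSTT x u)) * (θ / TSTT x u) ^ y / (Nat.factorial y : ℝ))
    (f : (ℕ → Fin R → ℝ) → ℕ → ℝ)
    (hf : ∀ (μ : ℕ → Fin R → ℝ), (∀ (i : ℕ) (r : Fin R), τmin ≤ μ i r ∧ μ i r ≤ τmax) →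
      ∀ k : ℕ, 1 ≤ k → f μ k =
      ∑' w : {w : Fin (k + 1) → ℕ // w 0 = 0 ∧ w (Fin.last k) = 0 ∧
          ∀ m : Fin (k + 1), m ≠ 0 → m ≠ Fin.last k → w m ≠ 0},
        ∏ m : Fin k, p (w.1 m.castSucc) (w.1 m.succ) (μ (w.1 m.castSucc)))
 :
    ∃ Nbar : ℝ, 0 < Nbar ∧
      ∀ μ : ℕ → Fin R → ℝ, (∀ (i : ℕ) (r : Fin R), τmin ≤ μ i r ∧ μ i r ≤ τmax) →
        (∑' k : ℕ, ENNReal.ofReal ((k : ℝ) * f μ k)) ≤ ENNReal.ofReal Nbar := by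
  have hne : Nonempty (Fin R) := ⟨⟨0, hR⟩⟩
  set c : ℝ := ∑ r, kl r * τmin with hc
  have hcpos : 0 < c := Finset.sum_pos (fun r _ => mul_pos (hklpos r) hτmin)
    Finset.univ_nonempty
  have hT : ∀ (x : ℕ) (u : Fin R → ℝ), (∀ r, τmin ≤ u r ∧ u r ≤ τmax) → c ≤ TSTT x u := by
    intro x u hu
    have h1 := hTSTT_lb x u hu
    have h2 : c ≤ ∑ r, kl r * u r := Finset.sum_le_sum fun r _ =>
      mul_le_mul_of_nonneg_left (hu r).1 (hklpos r).le
    have h3 : 0 ≤ k0l * (x : ℝ) := by positivity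
    linarith
  set L : ℝ := θ / c with hLdef
  have hLpos : 0 < L := div_pos hθ hcpos
  set q : ℝ := 1 - Real.exp (-L) with hq
  have hq1 : q < 1 := by have := Real.exp_pos (-L); linarith
  have hq0 : 0 < q := by
    have : Real.exp (-L) < 1 := by rw [← Real.exp_zero]; exact Real.exp_lt_exp.mpr (by linarith)
    linarith
  have hsum : Summable (fun k : ℕ => (k : ℝ) * q ^ k * q⁻¹) := by
    have := summable_pow_mul_geometric_of_norm_lt_one 1 (r := q)
      (by rw [Real.norm_eq_abs, abs_of_pos hq0]; exact hq1)
    simpa using this.mul_right q⁻¹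
  have hnn : ∀ k : ℕ, 0 ≤ (k : ℝ) * q ^ k * q⁻¹ := fun k => by positivity
  refine ⟨∑' k : ℕ, (k : ℝ) * q ^ k * q⁻¹ + 1,
    add_pos_of_nonneg_of_pos (tsum_nonneg hnn) one_pos, ?_⟩
  intro μ hμ
  refine le_trans ?_ (ENNReal.ofReal_le_ofReal (le_add_of_nonneg_right zero_le_one))
  rw [ENNReal.ofReal_tsum_of_nonneg hnn hsum]
  refine ENNReal.tsum_le_tsum fun k => ENNReal.ofReal_le_ofReal ?_
  rcases k with _ | k
  · simp
  have hl : ∀ x, 0 ≤ θ / TSTT x (μ x) ∧ θ / TSTT x (μ x) ≤ L := by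
    intro x
    have := hT x (μ x) (hμ x)
    exact ⟨div_nonneg hθ.le (hcpos.le.trans this),
      div_le_div_of_nonneg_left hθ.le hcpos this⟩
  have hpnn : ∀ x y, 0 ≤ p x y (μ x) := by
    intro x y
    rw [hp]
    have := (hl x).1
    positivity
  have key := aux_return (fun x y => ENNReal.ofReal (p x y (μ x))) (ENNReal.ofReal q)
    (fun x => by
      simp only [hp]
      exact aux_tail _ L (hl x).1 (hl x).2)
    (fun x => by
      rw [hp, ← ENNReal.ofReal_one]
      apply ENNReal.ofReal_le_ofReal
      simpa using (hl x).1) k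
  have hfk : f μ (k + 1) ≤ q ^ k := by
    rw [hf μ hμ (k + 1) (by omega)]
    apply Real.tsum_le_of_sum_le
    · intro w
      exact Finset.prod_nonneg fun m _ => hpnn _ _
    · intro s
      rw [← ENNReal.ofReal_le_ofReal_iff (by positivity), ENNReal.ofReal_pow hq0.le,
        ENNReal.ofReal_sum_of_nonneg (fun w _ => Finset.prod_nonneg fun m _ => hpnn _ _)]
      refine le_trans (ENNReal.sum_le_tsum s) (le_trans (le_of_eq ?_) key)
      refine tsum_congr fun w => ?_
      exact ENNReal.ofReal_prod_of_nonneg fun m _ => hpnn _ _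
  have : (((k + 1 : ℕ) : ℝ)) * q ^ (k + 1) * q⁻¹ = ((k + 1 : ℕ) : ℝ) * q ^ k := by
    rw [pow_succ, mul_assoc, mul_assoc, mul_inv_cancel₀ hq0.ne', mul_one]
  rw [this]
  exact mul_le_mul_of_nonneg_left hfk (by positivity)
end

section
/- The expected cost per time step is uniformly bounded: for every state x ∈ ℕ and every feasible toll vector u, g(x,u) ≤ φmax, where φmax = k0m·θ/(Σ_r (kl r)·τmin) + Σ_r (km r)·τmax. -/
lemma aux_exp (l : ℝ) : HasSum (fun y : ℕ => Real.exp (-l) * l ^ y / (Nat.factorial y : ℝ)) 1 := by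
  have h : HasSum (fun y : ℕ => l ^ y / (Nat.factorial y : ℝ)) (Real.exp l) := by
    rw [Real.exp_eq_exp_ℝ]
    exact NormedSpace.expSeries_div_hasSum_exp l
  have h2 := h.mul_left (Real.exp (-l))
  rw [← Real.exp_add, neg_add_cancel, Real.exp_zero] at h2
  simpa only [mul_div_assoc] using h2

lemma aux_mean (l : ℝ) :
    HasSum (fun y : ℕ => Real.exp (-l) * l ^ y / (Nat.factorial y : ℝ) * (y : ℝ)) l := by
  rw [← hasSum_nat_add_iff' 1]
  have h := (aux_exp l).mul_left l
  simp only [Finset.range_one, Finset.sum_singleton, Nat.cast_zero, mul_zero, sub_zero]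
  rw [mul_one] at h
  have e : (fun y : ℕ => Real.exp (-l) * l ^ (y + 1) / (Nat.factorial (y + 1) : ℝ) *
      ((y + 1 : ℕ) : ℝ)) = fun y : ℕ => l * (Real.exp (-l) * l ^ y / (Nat.factorial y : ℝ)) := by
    funext y
    rw [Nat.factorial_succ]
    have : (Nat.factorial y : ℝ) ≠ 0 := by positivity
    push_cast
    field_simp
    ring
  rw [e]
  exact h

theorem stmt7
    (R : ℕ) (hR : 1 ≤ R)
    (θ τmin τmax : ℝ) (hθ : 0 < θ) (hτmin : 0 < τmin) (hττ : τmin ≤ τmax)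
    (TSTT : ℕ → (Fin R → ℝ) → ℝ)
    (k0l k0m : ℝ) (kl km : Fin R → ℝ)
    (hk0l : 0 < k0l) (hk0 : k0l ≤ k0m)
    (hklpos : ∀ r, 0 < kl r) (hklm : ∀ r, kl r ≤ km r)
    (hTSTT_lb : ∀ (x : ℕ) (u : Fin R → ℝ), (∀ r, τmin ≤ u r ∧ u r ≤ τmax) →
      k0l * x + ∑ r, kl r * u r ≤ TSTT x u)
    (hTSTT_ub : ∀ (x : ℕ) (u : Fin R → ℝ), (∀ r, τmin ≤ u r ∧ u r ≤ τmax) →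
      TSTT x u ≤ k0m * x + ∑ r, km r * u r)
    (p : ℕ → ℕ → (Fin R → ℝ) → ℝ)
    (hp : ∀ (x y : ℕ) (u : Fin R → ℝ), p x y u =
      Real.exp (-(θ / TSTT x u)) * (θ / TSTT x u) ^ y / (Nat.factorial y : ℝ))
    (g : ℕ → (Fin R → ℝ) → ℝ)
    (hg : ∀ (x : ℕ) (u : Fin R → ℝ), g x u = ∑' y : ℕ, p x y u * TSTT y u)
    (x : ℕ) (u : Fin R → ℝ) (hu : ∀ r, τmin ≤ u r ∧ u r ≤ τmax) :
    g x u ≤ k0m * θ / (∑ r, kl r * τmin) + ∑ r, km r * τmax := by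
  have hne : (Finset.univ : Finset (Fin R)).Nonempty := ⟨⟨0, hR⟩, Finset.mem_univ _⟩
  have hD : 0 < ∑ r, kl r * τmin := Finset.sum_pos (fun r _ => mul_pos (hklpos r) hτmin) hne
  have hk0m : 0 < k0m := hk0l.trans_le hk0
  have hlow : ∀ y : ℕ, ∑ r, kl r * τmin ≤ TSTT y u := by
    intro y
    have h1 : ∑ r, kl r * τmin ≤ ∑ r, kl r * u r :=
      Finset.sum_le_sum fun r _ => mul_le_mul_of_nonneg_left (hu r).1 (hklpos r).le
    have h2 : 0 ≤ k0l * (y : ℝ) := by positivity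
    linarith [hTSTT_lb y u hu]
  have hup : ∑ r, km r * u r ≤ ∑ r, km r * τmax :=
    Finset.sum_le_sum fun r _ =>
      mul_le_mul_of_nonneg_left (hu r).2 ((hklpos r).le.trans (hklm r))
  have hl : θ / TSTT x u ≤ θ / ∑ r, kl r * τmin :=
    div_le_div_of_nonneg_left hθ.le hD (hlow x)
  have hl0 : 0 ≤ θ / TSTT x u := div_nonneg hθ.le (hD.le.trans (hlow x))
  have hp0 : ∀ y, 0 ≤ p x y u := by
    intro y
    rw [hp]
    positivity
  have s1 : HasSum (fun y => p x y u) 1 := by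
    simp only [hp]
    exact aux_exp _
  have s2 : HasSum (fun y => p x y u * (y : ℝ)) (θ / TSTT x u) := by
    simp only [hp]
    exact aux_mean _
  have s3 := (s2.mul_left k0m).add (s1.mul_left (∑ r, km r * u r))
  have hle : ∀ y : ℕ, p x y u * TSTT y u ≤
      k0m * (p x y u * (y : ℝ)) + (∑ r, km r * u r) * p x y u := by
    intro y
    have := mul_le_mul_of_nonneg_left (hTSTT_ub y u hu) (hp0 y)
    linarith
  have s4 : Summable (fun y => p x y u * TSTT y u) :=
    Summable.of_nonneg_of_le (fun y => mul_nonneg (hp0 y) (hD.le.trans (hlow y))) hle s3.summable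
  have h5 := hasSum_le hle s4.hasSum s3
  have h6 := mul_le_mul_of_nonneg_left hl hk0m.le
  rw [hg, mul_div_assoc]
  linarith
end

section
/- The expected cost per time step is dominated by a multiple of the weight sequence: there exists a real constant M ≥ 0 such that for every state i ∈ ℕ and every feasible toll vector u, 0 ≤ g(i,u) ≤ M·v i (equivalently, the weighted sup-norm sup_{i ∈ ℕ} (sup over feasible u of g(i,u))/v i is finite). -/
theorem poisson_affine (l a c : ℝ) :
    HasSum (fun y : ℕ => Real.exp (-l) * l ^ y / (Nat.factorial y : ℝ) * (a * y + c))
      (a * l + c) := by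
  have h0 : HasSum (fun y : ℕ => l ^ y / (Nat.factorial y : ℝ)) (Real.exp l) := by
    rw [Real.exp_eq_exp_ℝ]
    exact NormedSpace.expSeries_div_hasSum_exp l
  have h1 : HasSum (fun y : ℕ => l ^ y / (Nat.factorial y : ℝ) * y) (l * Real.exp l) := by
    rw [← hasSum_nat_add_iff' 1]
    have h2 := h0.mul_left l
    simp only [Finset.sum_range_one, Nat.cast_zero, mul_zero, sub_zero]
    refine h2.congr_fun ?_
    intro y
    have : (Nat.factorial y : ℝ) ≠ 0 := by positivity
    have h3 : (y : ℝ) + 1 ≠ 0 := by positivity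
    rw [Nat.factorial_succ]
    push_cast
    field_simp
    ring
  have h2 := ((h1.mul_left a).add (h0.mul_left c)).mul_left (Real.exp (-l))
  have e : Real.exp (-l) * (a * (l * Real.exp l) + c * Real.exp l) = a * l + c := by
    have : Real.exp (-l) * Real.exp l = 1 := by rw [← Real.exp_add]; simp
    linear_combination (a * l + c) * this
  rw [e] at h2
  refine h2.congr_fun ?_
  intro y
  ring

theorem stmt9
    (R : ℕ) (hR : 1 ≤ R)
    (θ τmin τmax : ℝ) (hθ : 0 < θ) (hτmin : 0 < τmin) (hττ : τmin ≤ τmax)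
    (TSTT : ℕ → (Fin R → ℝ) → ℝ)
    (k0l k0m : ℝ) (kl km : Fin R → ℝ)
    (hk0l : 0 < k0l) (hk0 : k0l ≤ k0m)
    (hklpos : ∀ r, 0 < kl r) (hklm : ∀ r, kl r ≤ km r)
    (hTSTT_lb : ∀ (x : ℕ) (u : Fin R → ℝ), (∀ r, τmin ≤ u r ∧ u r ≤ τmax) →
      k0l * x + ∑ r, kl r * u r ≤ TSTT x u)
    (hTSTT_ub : ∀ (x : ℕ) (u : Fin R → ℝ), (∀ r, τmin ≤ u r ∧ u r ≤ τmax) →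
      TSTT x u ≤ k0m * x + ∑ r, km r * u r)
    (p : ℕ → ℕ → (Fin R → ℝ) → ℝ)
    (hp : ∀ (x y : ℕ) (u : Fin R → ℝ), p x y u =
      Real.exp (-(θ / TSTT x u)) * (θ / TSTT x u) ^ y / (Nat.factorial y : ℝ))
    (g : ℕ → (Fin R → ℝ) → ℝ)
    (hg : ∀ (x : ℕ) (u : Fin R → ℝ), g x u = ∑' y : ℕ, p x y u * TSTT y u)
    (v : ℕ → ℝ) (hv : ∀ i : ℕ, v i = k0m * i + ∑ r, km r * τmax)
 :
    ∃ M : ℝ, 0 ≤ M ∧ ∀ (i : ℕ) (u : Fin R → ℝ), (∀ r, τmin ≤ u r ∧ u r ≤ τmax) →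
      0 ≤ g i u ∧ g i u ≤ M * v i := by
  have hne : (Finset.univ : Finset (Fin R)).Nonempty := ⟨⟨0, hR⟩, Finset.mem_univ _⟩
  have hL : 0 < ∑ r, kl r * τmin :=
    Finset.sum_pos (fun r _ => mul_pos (hklpos r) hτmin) hne
  have hC : 0 < ∑ r, km r * τmax :=
    Finset.sum_pos (fun r _ => mul_pos ((hklpos r).trans_le (hklm r)) (hτmin.trans_le hττ)) hne
  have hk0m : 0 < k0m := hk0l.trans_le hk0
  set L := ∑ r, kl r * τmin with hLdef
  set C := ∑ r, km r * τmax with hCdef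
  have hB : 0 ≤ k0m * (θ / L) + C := by positivity
  refine ⟨(k0m * (θ / L) + C) / C, by positivity, ?_⟩
  intro i u hu
  have hlow : ∀ x : ℕ, L ≤ TSTT x u := by
    intro x
    have h1 := hTSTT_lb x u hu
    have h2 : L ≤ ∑ r, kl r * u r :=
      Finset.sum_le_sum fun r _ => mul_le_mul_of_nonneg_left (hu r).1 (hklpos r).le
    have h3 : 0 ≤ k0l * x := by positivity
    linarith
  have hup : ∀ x : ℕ, TSTT x u ≤ k0m * x + C := by
    intro x
    have h1 := hTSTT_ub x u hu
    have h2 : ∑ r, km r * u r ≤ C :=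
      Finset.sum_le_sum fun r _ =>
        mul_le_mul_of_nonneg_left (hu r).2 ((hklpos r).trans_le (hklm r)).le
    linarith
  have hT : 0 < TSTT i u := hL.trans_le (hlow i)
  have hpn : ∀ y, 0 ≤ p i y u := by
    intro y
    rw [hp]
    positivity
  have hterm : ∀ y, 0 ≤ p i y u * TSTT y u := fun y =>
    mul_nonneg (hpn y) (hL.le.trans (hlow y))
  have hle : ∀ y, p i y u * TSTT y u ≤ p i y u * (k0m * y + C) := fun y =>
    mul_le_mul_of_nonneg_left (hup y) (hpn y)
  have hs : HasSum (fun y : ℕ => p i y u * (k0m * y + C)) (k0m * (θ / TSTT i u) + C) := by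
    simp only [hp]
    exact poisson_affine _ _ _
  have hsum : Summable (fun y : ℕ => p i y u * TSTT y u) :=
    Summable.of_nonneg_of_le hterm hle hs.summable
  rw [hg]
  refine ⟨tsum_nonneg hterm, ?_⟩
  have h1 : ∑' y : ℕ, p i y u * TSTT y u ≤ k0m * (θ / TSTT i u) + C :=
    hasSum_le hle hsum.hasSum hs
  have h2 : θ / TSTT i u ≤ θ / L := div_le_div_of_nonneg_left hθ.le hL (hlow i)
  have h3 : k0m * (θ / TSTT i u) ≤ k0m * (θ / L) := mul_le_mul_of_nonneg_left h2 hk0m.le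
  have h4 : C ≤ v i := by
    rw [hv]
    have : 0 ≤ k0m * (i : ℝ) := by positivity
    linarith
  calc _ ≤ k0m * (θ / L) + C := by linarith
    _ = (k0m * (θ / L) + C) / C * C := by field_simp
    _ ≤ _ := mul_le_mul_of_nonneg_left h4 (by positivity)
end

section
/- For every state i ∈ ℕ and every feasible toll vector u, Σ_{y=0}^∞ p i y u · v y ≤ M′·v i, where M′ = (k0m·θ/(Σ_r (kl r)·τmin) + Σ_r (km r)·τmax)/(Σ_r (km r)·τmax); in particular, the weighted sup-norm sup_{i ∈ ℕ} (sup over feasible u of Σ_{y=0}^∞ p i y u · v y)/v i is finite. -/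
theorem stmt10
    (R : ℕ) (hR : 1 ≤ R)
    (θ τmin τmax : ℝ) (hθ : 0 < θ) (hτmin : 0 < τmin) (hττ : τmin ≤ τmax)
    (TSTT : ℕ → (Fin R → ℝ) → ℝ)
    (k0l k0m : ℝ) (kl km : Fin R → ℝ)
    (hk0l : 0 < k0l) (hk0 : k0l ≤ k0m)
    (hklpos : ∀ r, 0 < kl r) (hklm : ∀ r, kl r ≤ km r)
    (hTSTT_lb : ∀ (x : ℕ) (u : Fin R → ℝ), (∀ r, τmin ≤ u r ∧ u r ≤ τmax) →
      k0l * x + ∑ r, kl r * u r ≤ TSTT x u)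
    (hTSTT_ub : ∀ (x : ℕ) (u : Fin R → ℝ), (∀ r, τmin ≤ u r ∧ u r ≤ τmax) →
      TSTT x u ≤ k0m * x + ∑ r, km r * u r)
    (p : ℕ → ℕ → (Fin R → ℝ) → ℝ)
    (hp : ∀ (x y : ℕ) (u : Fin R → ℝ), p x y u =
      Real.exp (-(θ / TSTT x u)) * (θ / TSTT x u) ^ y / (Nat.factorial y : ℝ))
    (v : ℕ → ℝ) (hv : ∀ i : ℕ, v i = k0m * i + ∑ r, km r * τmax)
 :
    ∀ (i : ℕ) (u : Fin R → ℝ), (∀ r, τmin ≤ u r ∧ u r ≤ τmax) →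
      (∑' y : ℕ, p i y u * v y) ≤
        ((k0m * θ / (∑ r, kl r * τmin) + ∑ r, km r * τmax) / (∑ r, km r * τmax)) * v i := by
  intro i u hu
  have : Nonempty (Fin R) := ⟨⟨0, hR⟩⟩
  have hA : 0 < ∑ r, kl r * τmin :=
    Finset.sum_pos (fun r _ => mul_pos (hklpos r) hτmin) Finset.univ_nonempty
  have hB : 0 < ∑ r, km r * τmax :=
    Finset.sum_pos (fun r _ => mul_pos ((hklpos r).trans_le (hklm r)) (hτmin.trans_le hττ))
      Finset.univ_nonempty
  have hAT : ∑ r, kl r * τmin ≤ TSTT i u := by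
    have h1 : ∑ r, kl r * τmin ≤ ∑ r, kl r * u r :=
      Finset.sum_le_sum fun r _ => mul_le_mul_of_nonneg_left (hu r).1 (hklpos r).le
    have h2 := hTSTT_lb i u hu
    have h3 : 0 ≤ k0l * (i : ℝ) := by positivity
    linarith
  have hk : 0 < k0m := hk0l.trans_le hk0
  simp only [hp, hv]
  rw [(poisson_affine_hasSum (θ / TSTT i u) k0m (∑ r, km r * τmax)).tsum_eq]
  generalize (∑ r, km r * τmax) = B at *
  generalize (∑ r, kl r * τmin) = A at *
  have h1 : k0m * (θ / TSTT i u) ≤ k0m * θ / A := by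
    rw [mul_div_assoc]
    gcongr
  have h2 : 0 ≤ (k0m * θ / A + B) / B := by positivity
  have h3 : (k0m * θ / A + B) / B * B = k0m * θ / A + B := by field_simp
  have h4 : 0 ≤ (k0m * θ / A + B) / B * (k0m * (i : ℝ)) := by positivity
  rw [mul_add, h3]
  linarith
end

section
/- Let L = Σ_r (kl r)·τmin and C = Σ_r (km r)·τmax. If k0m·θ/L ≤ exp(−θ/L)·C, then for every state i ∈ ℕ and every feasible toll vector u, Σ_{y=1}^∞ p i y u · v y ≤ v i (the sum over states y ≥ 1, i.e. excluding y = 0), and the inequality is strict whenever i ≥ 1. -/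
theorem poisson_aux (l k C : ℝ) :
    HasSum (fun y : ℕ => Real.exp (-l) * l ^ (y + 1) / (Nat.factorial (y + 1) : ℝ) *
      (k * ((y + 1 : ℕ) : ℝ) + C)) (k * l + C * (1 - Real.exp (-l))) := by
  have h0 : HasSum (fun y : ℕ => l ^ y / (Nat.factorial y : ℝ)) (Real.exp l) := by
    rw [Real.exp_eq_exp_ℝ]
    exact NormedSpace.expSeries_div_hasSum_exp l
  have h1 : HasSum (fun y : ℕ => l ^ (y + 1) / (Nat.factorial (y + 1) : ℝ))
      (Real.exp l - 1) := by
    have := (hasSum_nat_add_iff' (f := fun y : ℕ => l ^ y / (Nat.factorial y : ℝ)) 1).2 h0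
    simpa using this
  have h2 := (h0.mul_left (Real.exp (-l) * k * l)).add (h1.mul_left (Real.exp (-l) * C))
  have he : Real.exp (-l) * Real.exp l = 1 := by rw [← Real.exp_add]; simp
  convert h2 using 1
  · rfl
  · funext y
    have : (Nat.factorial y : ℝ) ≠ 0 := by positivity
    have h' : ((y : ℝ) + 1) ≠ 0 := by positivity
    rw [Nat.factorial_succ]
    push_cast
    field_simp
    ring
  · linear_combination (-(k * l) - C) * he

theorem stmt11
    (R : ℕ) (hR : 1 ≤ R)
    (θ τmin τmax : ℝ) (hθ : 0 < θ) (hτmin : 0 < τmin) (hττ : τmin ≤ τmax)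
    (TSTT : ℕ → (Fin R → ℝ) → ℝ)
    (k0l k0m : ℝ) (kl km : Fin R → ℝ)
    (hk0l : 0 < k0l) (hk0 : k0l ≤ k0m)
    (hklpos : ∀ r, 0 < kl r) (hklm : ∀ r, kl r ≤ km r)
    (hTSTT_lb : ∀ (x : ℕ) (u : Fin R → ℝ), (∀ r, τmin ≤ u r ∧ u r ≤ τmax) →
      k0l * x + ∑ r, kl r * u r ≤ TSTT x u)
    (hTSTT_ub : ∀ (x : ℕ) (u : Fin R → ℝ), (∀ r, τmin ≤ u r ∧ u r ≤ τmax) →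
      TSTT x u ≤ k0m * x + ∑ r, km r * u r)
    (p : ℕ → ℕ → (Fin R → ℝ) → ℝ)
    (hp : ∀ (x y : ℕ) (u : Fin R → ℝ), p x y u =
      Real.exp (-(θ / TSTT x u)) * (θ / TSTT x u) ^ y / (Nat.factorial y : ℝ))
    (v : ℕ → ℝ) (hv : ∀ i : ℕ, v i = k0m * i + ∑ r, km r * τmax)
    (hcond : k0m * θ / (∑ r, kl r * τmin) ≤
      Real.exp (-(θ / (∑ r, kl r * τmin))) * (∑ r, km r * τmax)) :
    ∀ (i : ℕ) (u : Fin R → ℝ), (∀ r, τmin ≤ u r ∧ u r ≤ τmax) →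
      (∑' y : ℕ, p i (y + 1) u * v (y + 1)) ≤ v i ∧
      (1 ≤ i → (∑' y : ℕ, p i (y + 1) u * v (y + 1)) < v i) := by
  intro i u hu
  have hk0m : 0 < k0m := lt_of_lt_of_le hk0l hk0
  have : Nonempty (Fin R) := ⟨⟨0, hR⟩⟩
  have hL : 0 < ∑ r, kl r * τmin :=
    Finset.sum_pos (fun r _ => mul_pos (hklpos r) hτmin) Finset.univ_nonempty
  have hC : 0 < ∑ r, km r * τmax :=
    Finset.sum_pos (fun r _ => mul_pos (lt_of_lt_of_le (hklpos r) (hklm r))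
      (lt_of_lt_of_le hτmin hττ)) Finset.univ_nonempty
  have hLT : ∑ r, kl r * τmin ≤ TSTT i u := by
    have h1 : ∑ r, kl r * τmin ≤ ∑ r, kl r * u r :=
      Finset.sum_le_sum fun r _ => mul_le_mul_of_nonneg_left (hu r).1 (hklpos r).le
    have h2 : 0 ≤ k0l * (i : ℝ) := by positivity
    linarith [hTSTT_lb i u hu]
  have hS : (∑' y : ℕ, p i (y + 1) u * v (y + 1)) = k0m * (θ / TSTT i u) +
      (∑ r, km r * τmax) * (1 - Real.exp (-(θ / TSTT i u))) := by
    simp only [hp, hv]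
    exact (poisson_aux _ _ _).tsum_eq
  rw [hS, hv]
  generalize (∑ r, km r * τmax) = C at *
  generalize (∑ r, kl r * τmin) = L at *
  have hl : θ / TSTT i u ≤ θ / L := div_le_div_of_nonneg_left hθ.le hL hLT
  have h3 : Real.exp (-(θ / L)) * C ≤ Real.exp (-(θ / TSTT i u)) * C :=
    mul_le_mul_of_nonneg_right (Real.exp_le_exp.2 (neg_le_neg hl)) hC.le
  have h4 : k0m * (θ / TSTT i u) ≤ k0m * (θ / L) := mul_le_mul_of_nonneg_left hl hk0m.le
  rw [mul_div_assoc] at hcond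
  refine ⟨?_, fun hi => ?_⟩
  · have : 0 ≤ k0m * (i : ℝ) := by positivity
    linarith
  · have : 0 < k0m * (i : ℝ) := mul_pos hk0m (by exact_mod_cast hi)
    linarith
end
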